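/- Let Γ be a torsion-free discrete subgroup of PSL(2,ℂ) of finite covolume, contained in PSL(2,R) where R is a finitely generated subring of a number field k. Then every maximal cyclic parabolic subgroup H of Γ is closed in the congruence topology on Γ: for every γ ∈ Γ − H there is a non-zero ideal I of R such that the image of γ under the congruence homomorphism Γ → PSL(2,R/I) does not lie in the image of H. -/

import Mathlib

set_option synthInstance.maxHeartbeats 400000
set_option maxHeartbeats 800000

open Matrix MeasureTheory

/-- The special linear group `SL(2, ℂ)`, topologized as a subspace of the matrices. -/
abbrev SL2C := Matrix.SpecialLinearGroup (Fin 2) ℂ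

noncomputable instance : TopologicalSpace SL2C := instTopologicalSpaceSubtype

/-- `PSL(2, ℂ)`: the quotient of `SL(2, ℂ)` by its center `{±I}`. -/
abbrev PSL2C := SL2C ⧸ Subgroup.center SL2C

noncomputable instance : MeasurableSpace PSL2C := borel _

/-- A subset `X` of a group `G` is separable (closed in the profinite topology) if for
every `γ ∈ G − X` there is a homomorphism `φ` from `G` to a finite group with
`φ γ ∉ φ '' X`. -/
def IsSeparableSubset {G : Type} [Group G] (X : Set G) : Prop :=
  ∀ γ : G, γ ∉ X → ∃ (F : Type) (_ : Group F) (_ : Finite F) (φ : G →* F), φ γ ∉ φ '' X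

/-- A subgroup `Γ ≤ PSL(2, ℂ)` has finite covolume if, with respect to a Haar measure
`μ` on `PSL(2, ℂ)`, the action of `Γ` on `PSL(2, ℂ)` admits a fundamental domain of
finite measure (equivalently, the quotient carries an induced invariant measure of
finite total mass). -/
def HasFiniteCovolume (Γ : Subgroup PSL2C) : Prop :=
  ∃ μ : Measure PSL2C, μ.IsHaarMeasure ∧
    ∃ s : Set PSL2C, IsFundamentalDomain (↥Γ) s μ ∧ μ s ≠ ⊤

/-- A non-identity element of `PSL(2, ℂ)` is parabolic if its representatives in
`SL(2, ℂ)` have trace `±2`. -/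
def IsParabolic (x : PSL2C) : Prop :=
  x ≠ 1 ∧ ∃ A : SL2C, (QuotientGroup.mk A : PSL2C) = x ∧
    (Matrix.trace (A : Matrix (Fin 2) (Fin 2) ℂ) = 2 ∨
     Matrix.trace (A : Matrix (Fin 2) (Fin 2) ℂ) = -2)

/-- An element of `PSL(2, ℂ)` is loxodromic if the square of the trace of a
representative in `SL(2, ℂ)` is not a real number in the interval `[0, 4]`. -/
def IsLoxodromic (x : PSL2C) : Prop :=
  ∃ A : SL2C, (QuotientGroup.mk A : PSL2C) = x ∧
    ∀ r : ℝ, 0 ≤ r → r ≤ 4 → (Matrix.trace (A : Matrix (Fin 2) (Fin 2) ℂ)) ^ 2 ≠ (r : ℂ)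

/-- A maximal parabolic subgroup of `Γ ≤ PSL(2, ℂ)`: a subgroup all of whose
non-identity elements are parabolic, maximal among such subgroups of `Γ`. -/
def IsMaxParabolicSubgroup (Γ : Subgroup PSL2C) (P : Subgroup ↥Γ) : Prop :=
  (∀ x ∈ P, x ≠ 1 → IsParabolic (x : PSL2C)) ∧
  ∀ P' : Subgroup ↥Γ, (∀ x ∈ P', x ≠ 1 → IsParabolic (x : PSL2C)) → P ≤ P' → P' = P

/-- A maximal cyclic parabolic subgroup of `Γ ≤ PSL(2, ℂ)`: a cyclic subgroup
consisting of parabolic elements (and the identity), maximal among cyclic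
subgroups of `Γ`. -/
def IsMaxCyclicParabolicSubgroup (Γ : Subgroup PSL2C) (P : Subgroup ↥Γ) : Prop :=
  (∃ x : ↥Γ, P = Subgroup.zpowers x) ∧
  (∀ x ∈ P, x ≠ 1 → IsParabolic (x : PSL2C)) ∧
  ∀ P' : Subgroup ↥Γ, (∃ y : ↥Γ, P' = Subgroup.zpowers y) → P ≤ P' → P' = P

/-- A loxodromic subgroup of `Γ ≤ PSL(2, ℂ)`: an infinite cyclic subgroup generated
by a loxodromic element. -/
def IsLoxodromicSubgroup (Γ : Subgroup PSL2C) (H : Subgroup ↥Γ) : Prop :=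
  ∃ x : ↥Γ, IsLoxodromic (x : PSL2C) ∧ ¬IsOfFinOrder x ∧ H = Subgroup.zpowers x

/-- `PSL(2, R)` for a commutative ring `R`: `SL(2, R)` modulo its center. -/
abbrev PSL2 (R : Type) [CommRing R] :=
  Matrix.SpecialLinearGroup (Fin 2) R ⧸ Subgroup.center (Matrix.SpecialLinearGroup (Fin 2) R)

/-- `Γ ≤ PSL(2, ℂ)` is contained in `PSL(2, R)` for a subring `R ≤ ℂ`: every element of
`Γ` is represented by a matrix in `SL(2, R)`. -/
def ContainedInPSL2 (R : Subring ℂ) (Γ : Subgroup PSL2C) : Prop :=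
  ∀ x : ↥Γ, ∃ A : Matrix.SpecialLinearGroup (Fin 2) ↥R,
    (QuotientGroup.mk (Matrix.SpecialLinearGroup.map R.subtype A) : PSL2C) = (x : PSL2C)

/-- A subset `X` of `Γ ≤ PSL(2, ℂ)`, with `Γ ⊆ PSL(2, R)`, is closed in the congruence
topology on `Γ` (with respect to `R`) if for every `γ ∈ Γ − X` there is a non-zero
ideal `I` of `R` such that the image of `γ` under the congruence homomorphism
`Γ → PSL(2, R) → PSL(2, R/I)` does not lie in the image of `X`.  The congruence
homomorphism `η` is characterized by sending any element of `Γ` represented by a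
matrix `A ∈ SL(2, R)` to the class of the reduction of `A` modulo `I`. -/
def CongruenceClosed (R : Subring ℂ) (Γ : Subgroup PSL2C) (X : Set ↥Γ) : Prop :=
  ∀ γ : ↥Γ, γ ∉ X → ∃ I : Ideal ↥R, I ≠ ⊥ ∧
    ∃ η : ↥Γ →* PSL2 (↥R ⧸ I),
      (∀ (x : ↥Γ) (A : Matrix.SpecialLinearGroup (Fin 2) ↥R),
        (QuotientGroup.mk (Matrix.SpecialLinearGroup.map R.subtype A) : PSL2C) = (x : PSL2C) →
        η x = QuotientGroup.mk (Matrix.SpecialLinearGroup.map (Ideal.Quotient.mk I) A)) ∧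
      η γ ∉ η '' X

/-- `R` is a finitely generated subring of a number field (a subfield of `ℂ` that is
finite-dimensional over `ℚ`). -/
def IsFGSubringOfNumberField (R : Subring ℂ) : Prop :=
  (∃ s : Finset ℂ, R = Subring.closure ↑s) ∧
  ∃ k : Subfield ℂ, FiniteDimensional ℚ ↥k ∧ R ≤ k.toSubring

lemma exists_pow_mul_map_eq_int (s : Finset ℂ) (hs : ∀ x ∈ s, IsAlgebraic ℚ x)
    (f : ℂ →ₗ[ℚ] ℚ) :
    ∃ M : ℤ, M ≠ 0 ∧ ∀ r ∈ Subring.closure (s : Set ℂ),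
      ∃ (j : ℕ) (z : ℤ), (M : ℚ) ^ j * f r = z := by
  obtain ⟨d, hd0, hd⟩ : ∃ d : ℤ, d ≠ 0 ∧ ∀ x ∈ s, IsIntegral ℤ (d • x) := by
    choose! c hc0 hc using fun x hx =>
      ((IsFractionRing.isAlgebraic_iff ℤ ℚ ℂ).2 (hs x hx)).exists_integral_multiple
    refine ⟨∏ x ∈ s, c x, Finset.prod_ne_zero_iff.2 hc0, fun x hx => ?_⟩
    rw [← Finset.prod_erase_mul s c hx, mul_smul]
    exact (hc x hx).smul _
  let T : Set ℂ := (fun x => d • x) '' (s : Set ℂ)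
  obtain ⟨G, hG⟩ := fg_adjoin_of_finite (R := ℤ) (s := T) (s.finite_toSet.image _)
    (by rintro _ ⟨x, hx, rfl⟩; exact hd x hx)
  obtain ⟨⟨D, hD0⟩, hD⟩ :=
    IsLocalization.exist_integer_multiples (nonZeroDivisors ℤ) (S := ℚ) G (fun g => f g)
  have hD0 : D ≠ 0 := nonZeroDivisors.ne_zero hD0
  have hA : ∀ a ∈ Algebra.adjoin ℤ T, ∃ z : ℤ, (D : ℚ) * f a = z := by
    intro a ha
    rw [← Subalgebra.mem_toSubmodule, ← hG] at ha
    induction ha using Submodule.span_induction with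
    | mem x hx =>
      obtain ⟨z, hz⟩ := hD x hx
      exact ⟨z, by simpa [Submonoid.smul_def] using hz.symm⟩
    | zero => exact ⟨0, by simp⟩
    | add x y _ _ hx hy =>
      obtain ⟨z, hz⟩ := hx
      obtain ⟨w, hw⟩ := hy
      exact ⟨z + w, by rw [map_add, mul_add, hz, hw]; push_cast; rfl⟩
    | smul n x _ hx =>
      obtain ⟨z, hz⟩ := hx
      exact ⟨n * z, by rw [map_zsmul, zsmul_eq_mul, mul_left_comm, hz]; push_cast; rfl⟩
  have key : ∀ r ∈ Subring.closure (s : Set ℂ),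
      ∃ j : ℕ, (d : ℂ) ^ j * r ∈ Algebra.adjoin ℤ T := by
    have hdA : (d : ℂ) ∈ Algebra.adjoin ℤ T := intCast_mem _ d
    intro r hr
    induction hr using Subring.closure_induction with
    | mem x hx => exact ⟨1, Algebra.subset_adjoin ⟨x, hx, by simp⟩⟩
    | zero => exact ⟨0, by simp [zero_mem]⟩
    | one => exact ⟨0, by simp [one_mem]⟩
    | add x y _ _ hx hy =>
      obtain ⟨i, hi⟩ := hx
      obtain ⟨j, hj⟩ := hy
      refine ⟨i + j, ?_⟩
      rw [show (d : ℂ) ^ (i + j) * (x + y) = d ^ j * (d ^ i * x) + d ^ i * (d ^ j * y) by ring]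
      exact add_mem (mul_mem (pow_mem hdA _) hi) (mul_mem (pow_mem hdA _) hj)
    | neg x _ hx =>
      obtain ⟨i, hi⟩ := hx
      exact ⟨i, by rw [mul_neg]; exact neg_mem hi⟩
    | mul x y _ _ hx hy =>
      obtain ⟨i, hi⟩ := hx
      obtain ⟨j, hj⟩ := hy
      refine ⟨i + j, ?_⟩
      rw [show (d : ℂ) ^ (i + j) * (x * y) = (d ^ i * x) * (d ^ j * y) by ring]
      exact mul_mem hi hj
  refine ⟨d * D, mul_ne_zero hd0 hD0, fun r hr => ?_⟩
  obtain ⟨j, hj⟩ := key r hr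
  obtain ⟨z, hz⟩ := hA _ hj
  have h : f ((d : ℂ) ^ j * r) = (d : ℚ) ^ j * f r := by
    rw [← smul_eq_mul (a := (d : ℚ) ^ j), ← map_smul, Algebra.smul_def]
    simp
  refine ⟨j + 1, d * D ^ j * z, ?_⟩
  rw [h] at hz
  push_cast
  rw [← hz]
  ring

lemma IsFGSubringOfNumberField.exists_nat_notMem {R : Subring ℂ} (hR : IsFGSubringOfNumberField R)
    {u v : ℂ} (huv : u ∉ Submodule.span ℚ {v}) :
    ∃ p : ℕ, p ≠ 0 ∧ ∀ r ∈ R, ∀ n : ℤ, u ≠ p * r + n * v := by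
  obtain ⟨⟨s, rfl⟩, k, hk, hRk⟩ := hR
  have hs : ∀ x ∈ s, IsAlgebraic ℚ x := by
    intro x hx
    have h : IsAlgebraic ℚ (⟨x, hRk (Subring.subset_closure hx)⟩ : k) :=
      Algebra.IsAlgebraic.isAlgebraic _
    exact (isAlgebraic_algebraMap_iff (algebraMap k ℂ).injective).2 h
  obtain ⟨g, hgu, hgv⟩ := Submodule.exists_le_ker_of_notMem huv
  have hgv : g v = 0 := hgv (Submodule.mem_span_singleton_self v)
  obtain ⟨M, hM0, hM⟩ := exists_pow_mul_map_eq_int s hs ((g u)⁻¹ • g)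
  obtain ⟨p, hp, hpp⟩ := Nat.exists_infinite_primes (M.natAbs + 1)
  refine ⟨p, hpp.ne_zero, fun r hr n h => ?_⟩
  obtain ⟨j, z, hz⟩ := hM r hr
  have h1 : (p : ℚ) * (((g u)⁻¹ • g) r) = 1 := by
    have h2 : g u = p * g r := by
      conv_lhs => rw [h]
      rw [map_add, ← zsmul_eq_mul, map_zsmul, hgv, ← nsmul_eq_mul, map_nsmul]
      simp
    rw [LinearMap.smul_apply, smul_eq_mul, mul_left_comm, ← h2, inv_mul_cancel₀ hgu]
  have h3 : (M : ℤ) ^ j = p * z := by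
    have : (M : ℚ) ^ j = p * z := by rw [← hz, mul_left_comm, h1, mul_one]
    exact_mod_cast this
  have h4 : (p : ℤ) ∣ M := (Nat.prime_iff_prime_int.1 hpp).dvd_of_dvd_pow ⟨z, h3⟩
  have h5 := Nat.le_of_dvd (Int.natAbs_pos.2 hM0) (Int.natCast_dvd.1 h4)
  omega

namespace Matrix.SpecialLinearGroup

variable {R : Type*} [CommRing R]

lemma coe_zpow_of_trace_eq_two {A : SpecialLinearGroup (Fin 2) R}
    (hA : (A : Matrix (Fin 2) (Fin 2) R).trace = 2) (n : ℤ) :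
    ((A ^ n : SpecialLinearGroup (Fin 2) R) : Matrix (Fin 2) (Fin 2) R) =
      1 + (n : R) • ((A : Matrix (Fin 2) (Fin 2) R) - 1) := by
  have hdet : A 0 0 * A 1 1 - A 0 1 * A 1 0 = 1 := by rw [← det_fin_two, A.det_coe]
  rw [trace_fin_two] at hA
  have h11 : A 1 1 = 2 - A 0 0 := by linear_combination hA
  rw [h11] at hdet
  induction n using Int.induction_on with
  | zero => simp
  | succ n ih =>
    have e : A ^ ((n : ℤ) + 1) = A ^ (n : ℤ) * A := _root_.zpow_add_one A n
    rw [e, coe_mul, ih]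
    ext i j
    fin_cases i <;> fin_cases j <;> simp [mul_apply, Fin.sum_univ_two, h11]
    · linear_combination (-n : R) * hdet
    · ring
    · ring
    · linear_combination (-n : R) * hdet
  | pred n ih =>
    have e : A ^ (-(n : ℤ) - 1) = A ^ (-(n : ℤ)) * A⁻¹ := _root_.zpow_sub_one A (-n)
    rw [e, coe_mul, ih, coe_inv, adjugate_fin_two]
    ext i j
    fin_cases i <;> fin_cases j <;> simp [mul_apply, Fin.sum_univ_two, h11]
    · linear_combination (-n : R) * hdet
    · ring
    · ring
    · linear_combination (-n : R) * hdet

lemma exists_ne_apply_ne_zero_of_trace_eq_two [IsDomain R] {A : SpecialLinearGroup (Fin 2) R}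
    (hA : (A : Matrix (Fin 2) (Fin 2) R).trace = 2) (h1 : A ≠ 1) :
    ∃ i j, i ≠ j ∧ A i j ≠ 0 := by
  by_contra! h
  have h01 := h 0 1 (by decide)
  have h10 := h 1 0 (by decide)
  have hdet : A 0 0 * A 1 1 - A 0 1 * A 1 0 = 1 := by rw [← det_fin_two, A.det_coe]
  rw [trace_fin_two] at hA
  have h00 : A 0 0 = 1 := by
    have : (A 0 0 - 1) ^ 2 = 0 := by
      linear_combination A 0 0 * hA - hdet - A 1 0 * h01
    exact sub_eq_zero.1 (pow_eq_zero_iff two_ne_zero |>.1 this)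
  have h11 : A 1 1 = 1 := by linear_combination hA - h00
  apply h1
  ext i j
  fin_cases i <;> fin_cases j <;> simp [h01, h10, h00, h11]

lemma exists_eq_smul_of_commute {K : Type*} [Field K] [NeZero (2 : K)]
    {A B : SpecialLinearGroup (Fin 2) K}
    (hA : (A : Matrix (Fin 2) (Fin 2) K).trace = 2) (h1 : A ≠ 1) (hAB : A * B = B * A) :
    ∃ s t : K, (s = 1 ∨ s = -1) ∧ (B : Matrix (Fin 2) (Fin 2) K) =
      s • (1 + t • ((A : Matrix (Fin 2) (Fin 2) K) - 1)) := by
  have h2 : (2 : K) ≠ 0 := NeZero.ne _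
  have hdet : A 0 0 * A 1 1 - A 0 1 * A 1 0 = 1 := by rw [← det_fin_two, A.det_coe]
  have hdetB : B 0 0 * B 1 1 - B 0 1 * B 1 0 = 1 := by rw [← det_fin_two, B.det_coe]
  have hA' := hA
  rw [trace_fin_two] at hA'
  have h11 : A 1 1 = 2 - A 0 0 := by linear_combination hA'
  have e : ∀ i j, (A * B) i j = (B * A) i j := fun i j => by rw [hAB]
  have e00 := e 0 0
  have e01 := e 0 1
  have e10 := e 1 0
  simp only [coe_mul, mul_apply, Fin.sum_univ_two, h11] at e00 e01 e10
  rw [h11] at hdet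
  obtain ⟨t, ht00, ht01, ht10⟩ :
      ∃ t, B 0 0 - B 1 1 = 2 * t * (A 0 0 - 1) ∧ B 0 1 = t * A 0 1 ∧ B 1 0 = t * A 1 0 := by
    obtain ⟨i, j, hij, h⟩ := exists_ne_apply_ne_zero_of_trace_eq_two hA h1
    fin_cases i <;> fin_cases j <;> simp at hij h
    · refine ⟨B 0 1 / A 0 1, ?_, ?_, ?_⟩ <;> field_simp
      · linear_combination -e01
      · linear_combination e00
    · refine ⟨B 1 0 / A 1 0, ?_, ?_, ?_⟩ <;> field_simp
      · linear_combination e10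
      · linear_combination -e00
  obtain ⟨s, hs⟩ : ∃ s, 2 * s = B 0 0 + B 1 1 := ⟨(B 0 0 + B 1 1) / 2, by field_simp⟩
  have hb0 : B 0 0 = s + t * (A 0 0 - 1) := by
    apply mul_left_cancel₀ h2; linear_combination ht00 - hs
  have hb1 : B 1 1 = s - t * (A 0 0 - 1) := by
    apply mul_left_cancel₀ h2; linear_combination -ht00 - hs
  rw [hb0, hb1, ht01, ht10] at hdetB
  have hs1 : s ^ 2 = 1 := by linear_combination hdetB - t ^ 2 * hdet
  refine ⟨s, s * t, sq_eq_one_iff.1 hs1, ?_⟩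
  ext i j
  fin_cases i <;> fin_cases j <;> simp [hb0, hb1, ht01, ht10, h11]
  · linear_combination (-t * (A 0 0 - 1)) * hs1
  · linear_combination (-t * A 0 1) * hs1
  · linear_combination (-t * A 1 0) * hs1
  · linear_combination (t * (A 0 0 - 1)) * hs1

lemma map_mem_center_of_mem_center {S : Type*} [CommRing S] {n : Type*} [Fintype n]
    [DecidableEq n] (f : R →+* S)
    {A : SpecialLinearGroup n R} (hA : A ∈ Subgroup.center (SpecialLinearGroup n R)) :
    map f A ∈ Subgroup.center (SpecialLinearGroup n S) := by
  obtain ⟨r, hr, h⟩ := mem_center_iff.1 hA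
  refine mem_center_iff.2 ⟨f r, by rw [← map_pow, hr, map_one], ?_⟩
  ext i j
  rw [map_apply_coe, ← h]
  simp [diagonal_apply, apply_ite f]

lemma mem_center_of_map_mem_center {S : Type*} [CommRing S] {n : Type*} [Fintype n]
    [DecidableEq n] {f : R →+* S}
    (hf : Function.Injective f) {A : SpecialLinearGroup n R}
    (hA : map f A ∈ Subgroup.center (SpecialLinearGroup n S)) :
    A ∈ Subgroup.center (SpecialLinearGroup n R) := by
  have hinj : Function.Injective (map (n := n) f) := by
    intro A B h
    ext i j
    exact hf (congrFun (congrFun (congrArg Subtype.val h) i) j)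
  refine Subgroup.mem_center_iff.2 fun B => hinj ?_
  rw [map_mul, map_mul]
  exact Subgroup.mem_center_iff.1 hA _

lemma neg_one_mem_center : (-1 : SpecialLinearGroup (Fin 2) R) ∈ Subgroup.center _ :=
  Subgroup.mem_center_iff.2 fun B => by ext; simp

lemma mk_neg_eq_mk (A : SpecialLinearGroup (Fin 2) R) :
    ((-A : SpecialLinearGroup (Fin 2) R) : SpecialLinearGroup (Fin 2) R ⧸ Subgroup.center _) =
      A := by
  rw [QuotientGroup.eq]
  convert neg_one_mem_center (R := R) using 1
  rw [inv_mul_eq_iff_eq_mul]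
  simp

lemma coe_eq_smul_of_mk_eq_mk {A B : SpecialLinearGroup (Fin 2) R}
    (h : (A : SpecialLinearGroup (Fin 2) R ⧸ Subgroup.center (SpecialLinearGroup (Fin 2) R)) = B) :
    ∃ r : R, r ^ 2 = 1 ∧ (B : Matrix (Fin 2) (Fin 2) R) = r • (A : Matrix (Fin 2) (Fin 2) R) := by
  obtain ⟨r, hr, h⟩ := mem_center_iff.1 (QuotientGroup.eq.1 h)
  refine ⟨r, by simpa using hr, ?_⟩
  have : B = A * (A⁻¹ * B) := by group
  rw [this, coe_mul, ← h]
  simp [smul_eq_mul_diagonal]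

lemma commute_of_coe_eq_smul_zpow {A B : SpecialLinearGroup (Fin 2) R} {c : R} {n : ℤ}
    (h : (B : Matrix (Fin 2) (Fin 2) R) =
      c • ((A ^ n : SpecialLinearGroup (Fin 2) R) : Matrix (Fin 2) (Fin 2) R)) :
    Commute A B := by
  have hAB : (A : Matrix (Fin 2) (Fin 2) R) * B = B * A := by
    rw [h, mul_smul_comm, smul_mul_assoc, ← coe_mul, ← coe_mul, ((Commute.refl A).zpow_right n).eq]
  ext i j
  exact congrFun (congrFun hAB i) j

end Matrix.SpecialLinearGroup

open Matrix.SpecialLinearGroup in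
/-- The congruence homomorphism `Γ → PSL(2, R / I)`. -/
lemma ContainedInPSL2.exists_congruenceHom {R : Subring ℂ} {Γ : Subgroup PSL2C}
    (hΓR : ContainedInPSL2 R Γ) (I : Ideal ↥R) :
    ∃ η : ↥Γ →* PSL2 (↥R ⧸ I), ∀ (x : ↥Γ) (A : Matrix.SpecialLinearGroup (Fin 2) ↥R),
      (QuotientGroup.mk (Matrix.SpecialLinearGroup.map R.subtype A) : PSL2C) = (x : PSL2C) →
      η x = QuotientGroup.mk (Matrix.SpecialLinearGroup.map (Ideal.Quotient.mk I) A) := by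
  let φ : PSL2 ↥R →* PSL2C := QuotientGroup.map _ _ (Matrix.SpecialLinearGroup.map R.subtype)
    fun _ h => map_mem_center_of_mem_center _ h
  let ψ : PSL2 ↥R →* PSL2 (↥R ⧸ I) :=
    QuotientGroup.map _ _ (Matrix.SpecialLinearGroup.map (Ideal.Quotient.mk I))
      fun _ h => map_mem_center_of_mem_center _ h
  have hφ : Function.Injective φ := by
    refine (injective_iff_map_eq_one φ).2 fun a ha => ?_
    induction a using QuotientGroup.induction_on with
    | H A =>
      exact (QuotientGroup.eq_one_iff A).2 (mem_center_of_map_mem_center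
        R.subtype_injective ((QuotientGroup.eq_one_iff _).1 ha))
  have hΓ : Γ ≤ φ.range := fun x hx => by
    obtain ⟨A, hA⟩ := hΓR ⟨x, hx⟩
    exact ⟨A, hA⟩
  refine ⟨ψ.comp ((MonoidHom.ofInjective hφ).symm.toMonoidHom.comp (Subgroup.inclusion hΓ)),
    fun x A hA => ?_⟩
  have h : (MonoidHom.ofInjective hφ).symm (Subgroup.inclusion hΓ x) = (A : PSL2 ↥R) := by
    rw [MulEquiv.symm_apply_eq]
    exact Subtype.ext hA.symm
  change ψ ((MonoidHom.ofInjective hφ).symm (Subgroup.inclusion hΓ x)) = _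
  rw [h]
  rfl

/-- If no power of `A` is congruent to a scalar multiple of `B` modulo `I`, then `I` separates the
class of `B` from the cyclic group generated by the class of `A`. -/
lemma ContainedInPSL2.exists_congruenceHom_notMem_image_zpowers {R : Subring ℂ}
    {Γ : Subgroup PSL2C} (hΓR : ContainedInPSL2 R Γ) {x γ : ↥Γ}
    {A B : Matrix.SpecialLinearGroup (Fin 2) ↥R}
    (hA : (QuotientGroup.mk (SpecialLinearGroup.map R.subtype A) : PSL2C) = x)
    (hB : (QuotientGroup.mk (SpecialLinearGroup.map R.subtype B) : PSL2C) = γ)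
    {I : Ideal ↥R} (hI : I ≠ ⊥)
    (h : ∀ (n : ℤ) (c : ↥R ⧸ I),
      (SpecialLinearGroup.map (Ideal.Quotient.mk I) B : Matrix (Fin 2) (Fin 2) (↥R ⧸ I)) ≠
        c • ((SpecialLinearGroup.map (Ideal.Quotient.mk I) A ^ n :
          Matrix.SpecialLinearGroup (Fin 2) (↥R ⧸ I)) : Matrix (Fin 2) (Fin 2) (↥R ⧸ I))) :
    ∃ I : Ideal ↥R, I ≠ ⊥ ∧ ∃ η : ↥Γ →* PSL2 (↥R ⧸ I),
      (∀ (x : ↥Γ) (A : Matrix.SpecialLinearGroup (Fin 2) ↥R),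
        (QuotientGroup.mk (Matrix.SpecialLinearGroup.map R.subtype A) : PSL2C) = (x : PSL2C) →
        η x = QuotientGroup.mk (Matrix.SpecialLinearGroup.map (Ideal.Quotient.mk I) A)) ∧
      η γ ∉ η '' (Subgroup.zpowers x : Set ↥Γ) := by
  obtain ⟨η, hη⟩ := hΓR.exists_congruenceHom I
  refine ⟨I, hI, η, hη, ?_⟩
  rintro ⟨_, ⟨n, rfl⟩, hn⟩
  simp only [map_zpow] at hn
  rw [hη x A hA, hη γ B hB, ← QuotientGroup.mk_zpow] at hn
  obtain ⟨c, -, hcB⟩ := SpecialLinearGroup.coe_eq_smul_of_mk_eq_mk hn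
  exact h n c hcB

open Matrix.SpecialLinearGroup in
lemma IsParabolic.exists_trace_eq_two {R : Subring ℂ} {x : PSL2C} (hx : IsParabolic x)
    {A : Matrix.SpecialLinearGroup (Fin 2) ↥R}
    (hA : (QuotientGroup.mk (Matrix.SpecialLinearGroup.map R.subtype A) : PSL2C) = x) :
    ∃ A' : Matrix.SpecialLinearGroup (Fin 2) ↥R,
      (QuotientGroup.mk (Matrix.SpecialLinearGroup.map R.subtype A') : PSL2C) = x ∧
      (A' : Matrix (Fin 2) (Fin 2) ↥R).trace = 2 := by
  obtain ⟨-, C, hC, htr⟩ := hx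
  obtain ⟨r, hr, h⟩ := coe_eq_smul_of_mk_eq_mk (hC.trans hA.symm)
  have hA2 : R.subtype (A : Matrix (Fin 2) (Fin 2) ↥R).trace =
      r * (C : Matrix (Fin 2) (Fin 2) ℂ).trace := by
    rw [← smul_eq_mul, ← Matrix.trace_smul, ← h]
    simp [Matrix.trace_fin_two]
  have hsq : R.subtype (A : Matrix (Fin 2) (Fin 2) ↥R).trace = 2 ∨
      R.subtype (A : Matrix (Fin 2) (Fin 2) ↥R).trace = -2 := by
    rcases sq_eq_one_iff.1 hr with rfl | rfl <;> rcases htr with h | h <;> simp [hA2, h]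
  rcases hsq with h | h
  · exact ⟨A, hA, R.subtype_injective (h.trans (map_ofNat R.subtype 2).symm)⟩
  · refine ⟨-A, ?_, R.subtype_injective ?_⟩
    · rw [← hA, ← mk_neg_eq_mk]
      congr 1
      ext i j
      simp
    · rw [coe_neg, Matrix.trace_neg, map_neg, h, neg_neg, map_ofNat]

/-- A maximal cyclic subgroup is closed under taking roots. -/
lemma mem_zpowers_of_zpow_eq_zpow {G : Type*} [Group G] {x g : G}
    (hmax : ∀ y : G, Subgroup.zpowers x ≤ Subgroup.zpowers y →
      Subgroup.zpowers y = Subgroup.zpowers x)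
    (hcomm : Commute x g) {a b : ℤ} (hab : IsCoprime a b) (h : g ^ b = x ^ a) :
    g ∈ Subgroup.zpowers x := by
  obtain ⟨i, j, hij⟩ := hab
  have hc : Commute (g ^ i) (x ^ j) := (hcomm.symm.zpow_zpow i j)
  have hx : (g ^ i * x ^ j) ^ b = x := by
    rw [hc.mul_zpow, ← _root_.zpow_mul, mul_comm i b, _root_.zpow_mul, h, ← _root_.zpow_mul,
      ← _root_.zpow_mul, ← _root_.zpow_add,
      mul_comm a i, hij, zpow_one]
  have hg : (g ^ i * x ^ j) ^ a = g := by
    rw [hc.mul_zpow, ← _root_.zpow_mul, ← _root_.zpow_mul, mul_comm j a, _root_.zpow_mul x, ← h,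
      ← _root_.zpow_mul, ← _root_.zpow_add,
      mul_comm b j, hij, zpow_one]
  rw [← hmax (g ^ i * x ^ j) (Subgroup.zpowers_le.2 ⟨b, hx⟩)]
  exact ⟨a, hg⟩

/-- Let `Γ ≤ PSL(2, ℂ)` be a torsion-free discrete subgroup of finite covolume
contained in `PSL(2, R)`, where `R` is a finitely generated subring of a number field.
Then every maximal cyclic parabolic subgroup `H` of `Γ` is closed in the congruence
topology on `Γ`. -/
theorem maximal_cyclic_parabolic_subgroup_congruence_closed
    (Γ : Subgroup PSL2C) (hdisc : DiscreteTopology ↥Γ) (hvol : HasFiniteCovolume Γ)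
    (htf : ∀ x : ↥Γ, IsOfFinOrder x → x = 1)
    (R : Subring ℂ) (hR : IsFGSubringOfNumberField R) (hΓR : ContainedInPSL2 R Γ)
    (H : Subgroup ↥Γ) (hH : IsMaxCyclicParabolicSubgroup Γ H) :
    CongruenceClosed R Γ (H : Set ↥Γ) := by
  obtain ⟨⟨x, rfl⟩, hpar, hmax⟩ := hH
  intro γ hγ
  replace hmax : ∀ y, Subgroup.zpowers x ≤ Subgroup.zpowers y →
      Subgroup.zpowers y = Subgroup.zpowers x := fun y hy => hmax _ ⟨y, rfl⟩ hy
  have hx1 : x ≠ 1 := by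
    rintro rfl
    exact hγ (hmax γ (by simp) ▸ Subgroup.mem_zpowers γ)
  obtain ⟨A₀, hA₀⟩ := hΓR x
  obtain ⟨A, hA, htr⟩ := (hpar x (Subgroup.mem_zpowers x) hx1).exists_trace_eq_two hA₀
  obtain ⟨B, hB⟩ := hΓR γ
  have hmem : ∀ {p : ℕ} {r : ↥R}, Ideal.Quotient.mk (Ideal.span {(p : ↥R)}) r = 0 →
      ∃ s ∈ R, (r : ℂ) = p * s := by
    intro p r h
    obtain ⟨s, rfl⟩ := Ideal.mem_span_singleton.1 (Ideal.Quotient.eq_zero_iff_mem.1 h)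
    exact ⟨s, s.2, by simp⟩
  by_cases hAB : A * B = B * A
  · have hA1 : A ≠ 1 := by
      rintro rfl
      exact hx1 (Subtype.ext (by rw [← hA, map_one]; rfl))
    have hAC : SpecialLinearGroup.map R.subtype A ≠ 1 := by
      intro h
      apply hA1
      ext i j
      have := congrFun (congrFun (congrArg Subtype.val h) i) j
      simpa [Matrix.one_apply, apply_ite] using this
    have htrC : ((SpecialLinearGroup.map R.subtype A : SL2C) : Matrix (Fin 2) (Fin 2) ℂ).trace =
        2 := by
      have := congrArg R.subtype htr
      rw [map_ofNat] at this
      simpa [Matrix.trace_fin_two] using this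
    obtain ⟨s, t, hs, hBC⟩ := SpecialLinearGroup.exists_eq_smul_of_commute
      (B := SpecialLinearGroup.map R.subtype B) htrC hAC
      (by rw [← map_mul, hAB, map_mul])
    obtain ⟨i, j, hij, hAij⟩ := SpecialLinearGroup.exists_ne_apply_ne_zero_of_trace_eq_two htr hA1
    have hs2 : s ^ 2 = 1 := by rcases hs with rfl | rfl <;> norm_num
    have hBij : ((B i j : ↥R) : ℂ) = s * t * (A i j : ↥R) := by
      have := congrFun (congrFun hBC i) j
      simpa [Matrix.one_apply_ne hij, mul_assoc] using this
    have hBtr : (((B : Matrix (Fin 2) (Fin 2) ↥R).trace : ↥R) : ℂ) = 2 * s := by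
      have := congrArg Matrix.trace hBC
      rw [Matrix.trace_smul, Matrix.trace_add, Matrix.trace_smul, Matrix.trace_sub, htrC] at this
      simp [Matrix.trace_fin_two] at this ⊢
      linear_combination this
    by_cases ht : ∃ q : ℚ, t = q
    · exfalso
      obtain ⟨q, rfl⟩ := ht
      obtain ⟨C, hCγ, hC⟩ : ∃ C : SL2C, (QuotientGroup.mk C : PSL2C) = γ ∧
          (C : Matrix (Fin 2) (Fin 2) ℂ) =
            1 + (q : ℂ) •
              ((SpecialLinearGroup.map R.subtype A : Matrix (Fin 2) (Fin 2) ℂ) - 1) := by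
        rcases hs with rfl | rfl
        · exact ⟨_, hB, by rw [hBC, one_smul]⟩
        · exact ⟨-SpecialLinearGroup.map R.subtype B,
            by rw [SpecialLinearGroup.mk_neg_eq_mk, hB],
            by rw [SpecialLinearGroup.coe_neg, hBC, neg_one_smul, neg_neg]⟩
      have hCtr : (C : Matrix (Fin 2) (Fin 2) ℂ).trace = 2 := by
        rw [hC, Matrix.trace_add, Matrix.trace_smul, Matrix.trace_sub, htrC]
        simp
      have hpow : C ^ (q.den : ℤ) = SpecialLinearGroup.map R.subtype A ^ q.num := by
        apply Subtype.ext
        rw [SpecialLinearGroup.coe_zpow_of_trace_eq_two hCtr,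
          SpecialLinearGroup.coe_zpow_of_trace_eq_two htrC, hC, add_sub_cancel_left,
          smul_smul]
        congr 2
        exact_mod_cast Rat.den_mul_eq_num q
      refine hγ (mem_zpowers_of_zpow_eq_zpow (a := q.num) (b := q.den) hmax ?_
        (Int.isCoprime_iff_gcd_eq_one.2 q.reduced) ?_)
      · apply Subtype.ext
        change (x : PSL2C) * γ = γ * x
        rw [← hA, ← hB, ← QuotientGroup.mk_mul, ← QuotientGroup.mk_mul, ← map_mul, hAB, map_mul]
      · apply Subtype.ext
        rw [Subgroup.coe_zpow, Subgroup.coe_zpow, ← hA, ← hCγ, ← QuotientGroup.mk_zpow,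
          ← QuotientGroup.mk_zpow, hpow]
    · obtain ⟨p, hp, hpn⟩ := hR.exists_nat_notMem
        (u := 2 * (B i j : ↥R)) (v := (B : Matrix (Fin 2) (Fin 2) ↥R).trace * (A i j : ↥R)) (by
          rw [Submodule.mem_span_singleton]
          rintro ⟨q, hq⟩
          apply ht
          rw [hBij, hBtr, Rat.smul_def] at hq
          have hA0 : ((A i j : ↥R) : ℂ) ≠ 0 := by simpa using hAij
          refine ⟨q, mul_right_cancel₀ hA0 ?_⟩
          linear_combination (-s / 2) * hq + (q - t) * (A i j : ↥R) * hs2)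
      refine hΓR.exists_congruenceHom_notMem_image_zpowers hA hB
        (I := Ideal.span {(p : ↥R)}) (by simpa using hp) fun n c h => ?_
      have htrQ : ((SpecialLinearGroup.map (Ideal.Quotient.mk (Ideal.span {(p : ↥R)})) A :
          SpecialLinearGroup (Fin 2) _) :
          Matrix (Fin 2) (Fin 2) (↥R ⧸ Ideal.span {(p : ↥R)})).trace = 2 := by
        have := congrArg (Ideal.Quotient.mk (Ideal.span {(p : ↥R)})) htr
        rw [map_ofNat] at this
        simpa [Matrix.trace_fin_two] using this
      rw [SpecialLinearGroup.coe_zpow_of_trace_eq_two htrQ] at h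
      have h1 := congrArg Matrix.trace h
      have h2 := congrFun (congrFun h i) j
      rw [Matrix.trace_smul, Matrix.trace_add, Matrix.trace_smul, Matrix.trace_sub, htrQ] at h1
      simp [Matrix.one_apply_ne hij] at h2
      simp [Matrix.trace_fin_two] at h1
      obtain ⟨r, hr, e⟩ := hmem (p := p)
        (r := 2 * B i j - n * ((B : Matrix (Fin 2) (Fin 2) ↥R).trace * A i j)) (by
          simp only [Matrix.trace_fin_two, map_sub, map_mul, map_add, map_intCast, map_ofNat]
          rw [h2, h1]
          ring)
      refine hpn r hr n ?_
      have h2 : ((2 : ↥R) : ℂ) = 2 := map_ofNat R.subtype 2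
      rw [← e]
      push_cast
      rw [h2]
      ring
  · obtain ⟨i, j, hij⟩ : ∃ i j, (A * B) i j - (B * A) i j ≠ 0 := by
      by_contra! h
      exact hAB (by ext i j; simpa using congrArg Subtype.val (sub_eq_zero.1 (h i j)))
    obtain ⟨p, hp, hpn⟩ := hR.exists_nat_notMem (u := ((A * B) i j - (B * A) i j : ↥R)) (v := 0)
      (by simpa only [Submodule.span_zero_singleton, Submodule.mem_bot,
        ZeroMemClass.coe_eq_zero] using hij)
    refine hΓR.exists_congruenceHom_notMem_image_zpowers hA hB
      (I := Ideal.span {(p : ↥R)}) (by simpa using hp) fun n c h => ?_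
    have hcomm : SpecialLinearGroup.map (Ideal.Quotient.mk (Ideal.span {(p : ↥R)})) (A * B) =
        SpecialLinearGroup.map (Ideal.Quotient.mk (Ideal.span {(p : ↥R)})) (B * A) := by
      rw [map_mul, map_mul]
      exact SpecialLinearGroup.commute_of_coe_eq_smul_zpow h
    obtain ⟨r, hr, e⟩ := hmem (p := p) (r := (A * B) i j - (B * A) i j) (by
      rw [map_sub, sub_eq_zero]
      exact congrFun (congrFun (congrArg Subtype.val hcomm) i) j)
    exact hpn r hr 0 (by simpa using e)
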